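/- arXiv:math/9808114 — 4 statements merged into one kernel-verified Lean document; each statement's English description precedes it below -/
import Mathlib

section
/- Let K be a field, V and W finite-dimensional K-vector spaces, f : V → W a K-linear map, and i a natural number. The induced K-linear map ⋀^i f : ⋀^i V → ⋀^i W between i-th exterior powers is nonzero if and only if i ≤ rank f. -/
open ExteriorAlgebra

/-- The `K`-linear map `⋀^i f : ⋀^i V → ⋀^i W` between `i`-th exterior powers
functorially induced by a linear map `f : V → W`. -/
noncomputable def exteriorPowerMap {K V W : Type*} [Field K] [AddCommGroup V] [Module K V]
    [AddCommGroup W] [Module K W] (i : ℕ) (f : V →ₗ[K] W) :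
    ⋀[K]^i V →ₗ[K] ⋀[K]^i W :=
  (ExteriorAlgebra.map f).toLinearMap.restrict (p := ⋀[K]^i V) (q := ⋀[K]^i W)
    (fun x hx => by
      have h : Submodule.map (ExteriorAlgebra.map f).toLinearMap
          ((LinearMap.range (ι K : V →ₗ[K] ExteriorAlgebra K V)) ^ i) ≤
          (LinearMap.range (ι K : W →ₗ[K] ExteriorAlgebra K W)) ^ i := by
        rw [Submodule.map_pow]
        refine pow_le_pow_left' ?_ i
        rw [ι_range_map_map]
        exact le_trans (Submodule.map_mono le_top) (le_of_eq (Submodule.map_top _))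
      exact h ⟨x, hx, rfl⟩)

/-- `exteriorPowerMap` agrees with Mathlib's `exteriorPower.map`. -/
lemma exteriorPowerMap_eq_map {K V W : Type*} [Field K] [AddCommGroup V] [Module K V]
    [AddCommGroup W] [Module K W] (i : ℕ) (f : V →ₗ[K] W) :
    exteriorPowerMap i f = exteriorPower.map i f := by
  refine exteriorPower.linearMap_ext (AlternatingMap.ext fun v => Subtype.ext ?_)
  simp [exteriorPowerMap, ExteriorAlgebra.map_apply_ιMulti, Function.comp_def]

/-- The map induced by `f` on `i`-th exterior powers is nonzero if and only if the `i`-th exterior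
power of the range of `f` is nontrivial. -/
lemma exteriorPower.map_ne_zero_iff_nontrivial {K V W : Type*} [Field K] [AddCommGroup V]
    [Module K V] [AddCommGroup W] [Module K W] (i : ℕ) (f : V →ₗ[K] W) :
    exteriorPower.map i f ≠ 0 ↔ Nontrivial (⋀[K]^i (LinearMap.range f)) := by
  have hsurj : Function.Surjective (exteriorPower.map i f.rangeRestrict) :=
    exteriorPower.map_surjective f.surjective_rangeRestrict
  have hinj : Function.Injective (exteriorPower.map i (LinearMap.range f).subtype) :=
    exteriorPower.map_injective_field (Submodule.injective_subtype _)
  have hcomp : exteriorPower.map i f =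
      exteriorPower.map i (LinearMap.range f).subtype ∘ₗ exteriorPower.map i f.rangeRestrict := by
    rw [← exteriorPower.map_comp, LinearMap.rangeRestrict, LinearMap.subtype_comp_codRestrict]
  rw [hcomp, ← not_subsingleton_iff_nontrivial, not_iff_not]
  constructor
  · intro h
    refine subsingleton_of_forall_eq 0 fun y => ?_
    obtain ⟨x, rfl⟩ := hsurj y
    apply hinj
    simpa using LinearMap.congr_fun h x
  · intro h
    rw [Subsingleton.elim (exteriorPower.map i f.rangeRestrict) 0, LinearMap.comp_zero]

/-- For finite-dimensional `V`, `W` over a field `K` and `f : V → W` linear, the induced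
map `⋀^i f : ⋀^i V → ⋀^i W` is nonzero if and only if `i ≤ rank f`. -/
theorem exteriorPowerMap_ne_zero_iff {K V W : Type*} [Field K] [AddCommGroup V] [Module K V]
    [AddCommGroup W] [Module K W] [FiniteDimensional K V] [FiniteDimensional K W]
    (f : V →ₗ[K] W) (i : ℕ) :
    exteriorPowerMap i f ≠ 0 ↔ i ≤ Module.finrank K (LinearMap.range f) := by
  rw [exteriorPowerMap_eq_map, exteriorPower.map_ne_zero_iff_nontrivial,
    ← Module.finrank_pos_iff (R := K), exteriorPower.finrank_eq, Nat.pos_iff_ne_zero,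
    Nat.choose_ne_zero_iff]
end

section
/- Let n, k be natural numbers and A an n × n complex matrix with Aᵀ = A. Then rank A ≤ k if and only if there exist vectors v_1, …, v_k ∈ ℂ^n such that A i j = ∑_{l=1}^{k} (v_l)_i · (v_l)_j for all indices i, j. -/
open Matrix

/-- A symmetric matrix over a field in which `2` is invertible is congruent to a diagonal matrix
of the same rank. -/
theorem Matrix.IsSymm.exists_eq_transpose_mul_diagonal_mul {K n : Type*} [Field K]
    [Invertible (2 : K)] [Fintype n] [DecidableEq n] {A : Matrix n n K} (hA : A.IsSymm) :
    ∃ (m : ℕ) (Q : Matrix (Fin m) n K) (d : Fin m → K),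
      A = Qᵀ * diagonal d * Q ∧ (diagonal d).rank = A.rank := by
  have hB : (Matrix.toBilin' A).IsSymm := by
    refine ⟨fun x y => ?_⟩
    rw [Matrix.toBilin'_apply', Matrix.toBilin'_apply', dotProduct_mulVec,
      ← mulVec_transpose, hA.eq, dotProduct_comm]
  obtain ⟨c, hc⟩ := LinearMap.BilinForm.exists_orthogonal_basis
    (LinearMap.BilinForm.isSymm_iff.mp hB)
  have hD : LinearMap.BilinForm.toMatrix c (Matrix.toBilin' A) =
      diagonal fun i => Matrix.toBilin' A (c i) (c i) := by
    ext i j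
    rw [LinearMap.BilinForm.toMatrix_apply]
    by_cases h : i = j
    · subst h; simp
    · rw [diagonal_apply_ne _ h]
      exact hc h
  have hA' : LinearMap.BilinForm.toMatrix (Pi.basisFun K n) (Matrix.toBilin' A) = A := by
    rw [LinearMap.BilinForm.toMatrix_basisFun, LinearMap.BilinForm.toMatrix'_toBilin']
  have h₁ := LinearMap.BilinForm.toMatrix_mul_basis_toMatrix c (Pi.basisFun K n)
    (Matrix.toBilin' A)
  have h₂ := LinearMap.BilinForm.toMatrix_mul_basis_toMatrix (Pi.basisFun K n) c
    (Matrix.toBilin' A)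
  rw [hA', hD] at h₁ h₂
  refine ⟨_, _, _, h₁.symm, le_antisymm ?_ ?_⟩
  · rw [← h₂]
    exact (rank_mul_le_left _ _).trans (rank_mul_le_right _ _)
  · conv_lhs => rw [← h₁]
    exact (rank_mul_le_left _ _).trans (rank_mul_le_right _ _)

/-- A symmetric `n × n` complex matrix has rank at most `k` if and only if it is a sum of `k`
symmetric rank-one matrices `A i j = ∑_{l} (v l) i * (v l) j`. -/
theorem symm_rank_le_iff_sum_rank_one (n k : ℕ) (A : Matrix (Fin n) (Fin n) ℂ)
    (hA : Aᵀ = A) :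
    A.rank ≤ k ↔ ∃ v : Fin k → Fin n → ℂ,
      ∀ (i j : Fin n), A i j = ∑ l : Fin k, v l i * v l j := by
  constructor
  · intro hk
    obtain ⟨m, Q, d, hQ, hd⟩ := Matrix.IsSymm.exists_eq_transpose_mul_diagonal_mul hA
    rw [← hd, rank_diagonal] at hk
    obtain ⟨e⟩ : Nonempty ({i // d i ≠ 0} ↪ Fin k) :=
      Function.Embedding.nonempty_of_card_le (by simpa using hk)
    choose s hs using fun i => IsAlgClosed.exists_pow_nat_eq (d i) (n := 2) two_pos
    refine ⟨Function.extend e (fun a => s a • Q a) 0, fun i j => ?_⟩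
    calc A i j = ∑ a, d a * (Q a i * Q a j) := by
          rw [hQ, mul_apply]
          refine Finset.sum_congr rfl fun a _ => ?_
          rw [mul_diagonal, transpose_apply]
          ring
      _ = ∑ a : {a // d a ≠ 0}, d a * (Q a i * Q a j) := by
          refine (Fintype.sum_of_injective _ Subtype.val_injective _ _ (fun a ha => ?_)
            fun _ => rfl).symm
          have h : d a = 0 := by simpa using ha
          rw [h, zero_mul]
      _ = _ := by
          refine Fintype.sum_of_injective e e.injective _ _ (fun l hl => ?_) fun a => ?_
          · rw [Function.extend_apply' _ _ _ hl]
            simp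
          · rw [e.injective.extend_apply, ← hs]
            simp only [Pi.smul_apply, smul_eq_mul]
            ring
  · rintro ⟨v, hv⟩
    have h : A = (of v)ᵀ * of v := by
      ext i j
      simp [mul_apply, hv]
    rw [h]
    exact (rank_mul_le_right _ _).trans (rank_le_height _)
end

section
/- Let K be a field, n, k natural numbers, and A an n × n matrix over K with Aᵀ = -A and A i i = 0 for all i. Then rank A ≤ 2k if and only if there exist vectors v_1, …, v_k and w_1, …, w_k in K^n such that A i j = ∑_{l=1}^{k} ((v_l)_i · (w_l)_j - (w_l)_i · (v_l)_j) for all indices i, j. -/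
open Matrix

namespace Matrix

variable {K ι : Type*} [Field K] [Fintype ι]

/-- A sum of `k` decomposable skew forms has rank at most `2k`. -/
theorem rank_le_two_mul_of_eq_sum {k : ℕ} {A : Matrix ι ι K} (v w : Fin k → ι → K)
    (h : ∀ i j, A i j = ∑ l, (v l i * w l j - w l i * v l j)) : A.rank ≤ 2 * k := by
  have hA : A = (of fun i => Sum.elim (fun l => v l i) (fun l => -w l i) : Matrix ι (Fin k ⊕ Fin k) K)
      * (of (Sum.elim w v) : Matrix (Fin k ⊕ Fin k) ι K) := by
    ext i j
    simp [h, mul_apply, Finset.sum_add_distrib, sub_eq_add_neg]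
  rw [hA]
  refine (rank_mul_le_left _ _).trans ((rank_le_card_width _).trans ?_)
  simp [two_mul]

/-- Subtracting the hyperbolic plane spanned by two columns which pair nontrivially lowers the
rank of an alternating matrix by at least two. -/
theorem rank_sub_hyperbolic_add_two_le {A B : Matrix ι ι K} (hA : ∀ i j, A j i = -A i j)
    (hd : ∀ i, A i i = 0) {p q : ι} (hpq : A p q ≠ 0)
    (hB : ∀ i j, B i j = A i j - (A p q)⁻¹ * (A i p * A j q - A i q * A j p)) :
    B.rank + 2 ≤ A.rank := by
  let g : (ι → K) →ₗ[K] K × K := (LinearMap.proj p).prod (LinearMap.proj q)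
  let h := g.domRestrict (LinearMap.range A.mulVecLin)
  have hcol (j : ι) : A.col j ∈ LinearMap.range A.mulVecLin := by
    rw [range_mulVecLin]
    exact Submodule.subset_span ⟨j, rfl⟩
  have hsurj : LinearMap.range h = ⊤ := by
    rw [LinearMap.range_eq_top]
    rintro ⟨a, b⟩
    refine ⟨⟨(a * (A p q)⁻¹) • A.col q - (b * (A p q)⁻¹) • A.col p,
      sub_mem (Submodule.smul_mem _ _ (hcol q)) (Submodule.smul_mem _ _ (hcol p))⟩, ?_⟩
    simp [h, g, hd, hA p q, hpq]
  have hle : LinearMap.range B.mulVecLin ≤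
      (LinearMap.ker h).map (LinearMap.range A.mulVecLin).subtype := by
    rw [range_mulVecLin, Submodule.span_le]
    rintro _ ⟨j, rfl⟩
    have hBj : B.col j = A.col j - ((A p q)⁻¹ * A j q) • A.col p
        + ((A p q)⁻¹ * A j p) • A.col q := by
      ext i
      simp only [col_apply, Pi.add_apply, Pi.sub_apply, Pi.smul_apply, smul_eq_mul, hB]
      ring
    refine ⟨⟨B.col j, ?_⟩, ?_, rfl⟩
    · rw [hBj]
      exact add_mem (sub_mem (hcol j) (Submodule.smul_mem _ _ (hcol p)))
        (Submodule.smul_mem _ _ (hcol q))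
    · have hp : B p j = 0 := by
        rw [hB, hd, hA p j]
        field_simp
        ring
      have hq : B q j = 0 := by
        rw [hB, hd, hA p q, hA q j]
        field_simp
        ring
      simp [h, g, hp, hq]
  have hker : B.rank ≤ Module.finrank K (LinearMap.ker h) :=
    (Submodule.finrank_mono hle).trans (Submodule.finrank_map_le _ _)
  have hrank := h.finrank_range_add_finrank_ker
  rw [hsurj, finrank_top, Module.finrank_prod, Module.finrank_self] at hrank
  change _ = A.rank at hrank
  omega

/-- An alternating matrix of rank at most `2k` is a sum of `k` decomposable skew forms. -/
theorem exists_eq_sum_of_rank_le_two_mul {k : ℕ} {A : Matrix ι ι K}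
    (hA : ∀ i j, A j i = -A i j) (hd : ∀ i, A i i = 0) (hk : A.rank ≤ 2 * k) :
    ∃ v w : Fin k → ι → K, ∀ i j, A i j = ∑ l, (v l i * w l j - w l i * v l j) := by
  induction k generalizing A with
  | zero =>
    refine ⟨0, 0, fun i j => ?_⟩
    by_contra hij
    have := rank_sub_hyperbolic_add_two_le (p := i) (q := j) hA hd (by simpa using hij)
      (B := of fun _ _ => _) fun _ _ => rfl
    omega
  | succ k ih =>
    by_cases h0 : ∀ i j, A i j = 0
    · exact ⟨0, 0, by simp [h0]⟩
    push Not at h0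
    obtain ⟨p, q, hpq⟩ := h0
    let B : Matrix ι ι K := of fun i j => A i j - (A p q)⁻¹ * (A i p * A j q - A i q * A j p)
    have hB := rank_sub_hyperbolic_add_two_le (B := B) hA hd hpq fun _ _ => rfl
    obtain ⟨v, w, h⟩ := ih (A := B)
      (fun i j => by
        simp only [B, of_apply, hA i j]
        ring)
      (fun i => by
        simp only [B, of_apply, hd]
        ring)
      (by omega)
    refine ⟨Fin.cons (fun i => (A p q)⁻¹ * A i p) v, Fin.cons (fun i => A i q) w, fun i j => ?_⟩
    rw [Fin.sum_univ_succ]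
    simp only [Fin.cons_zero, Fin.cons_succ, ← h, B, of_apply]
    ring

end Matrix

/-- An alternating `n × n` matrix over a field has rank at most `2k` if and only if it is a
sum of `k` alternating rank-two matrices
`A i j = ∑_{l} ((v l) i * (w l) j - (w l) i * (v l) j)`. -/
theorem alternating_rank_le_iff (K : Type*) [Field K] (n k : ℕ)
    (A : Matrix (Fin n) (Fin n) K) (hA : Aᵀ = -A) (hd : ∀ i, A i i = 0) :
    A.rank ≤ 2 * k ↔ ∃ (v w : Fin k → Fin n → K),
      ∀ (i j : Fin n), A i j = ∑ l : Fin k, (v l i * w l j - w l i * v l j) :=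
  ⟨exists_eq_sum_of_rank_le_two_mul (fun i j => congrFun₂ hA i j) hd,
    fun ⟨v, w, h⟩ => rank_le_two_mul_of_eq_sum v w h⟩
end

section
/- Let K be a field with more than 3 elements, V and W K-vector spaces, and U a K-subspace of V × W such that for every unit λ ∈ Kˣ and every (v, w) ∈ U, the point (λ • v, λ⁻¹ • w) also lies in U. Then for every (v, w) ∈ U, both (v, 0) and (0, w) lie in U; equivalently, U = (U ∩ (V × {0})) ⊕ (U ∩ ({0} × W)). -/
/-- A field with more than three elements has a unit different from its own inverse. -/
theorem exists_unit_sub_inv_ne_zero {K : Type*} [Field K] (hK : (3 : Cardinal) < Cardinal.mk K) :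
    ∃ lam : Kˣ, (lam : K) - ((lam⁻¹ : Kˣ) : K) ≠ 0 := by
  classical
  by_contra! h
  have hmem : ∀ x : K, x ∈ ({0, 1, -1} : Finset K) := by
    intro x
    by_cases hx : x = 0
    · simp [hx]
    · have hinv : x = x⁻¹ := by simpa [sub_eq_zero] using h (Units.mk0 x hx)
      have hsq : x * x = 1 := by
        nth_rewrite 2 [hinv]
        exact mul_inv_cancel₀ hx
      simpa [hx] using mul_self_eq_one_iff.mp hsq
  have hcard : Cardinal.mk K ≤ 3 := by
    rw [← Cardinal.mk_univ, ← Set.eq_univ_of_forall (s := (({0, 1, -1} : Finset K) : Set K)) hmem]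
    simp only [Finset.coe_sort_coe, Cardinal.mk_coe_finset]
    exact_mod_cast Finset.card_le_three
  exact absurd hK hcard.not_gt

/-- Over a field with more than 3 elements, a subspace `U ⊆ V × W` invariant under the
action `λ · (v, w) = (λ v, λ⁻¹ w)` of `Kˣ` splits: every `(v, w) ∈ U` has `(v, 0) ∈ U` and
`(0, w) ∈ U`; equivalently `U = (U ∩ (V × {0})) ⊕ (U ∩ ({0} × W))`. -/
theorem torus_invariant_subspace_splits (K V W : Type*) [Field K] [AddCommGroup V]
    [Module K V] [AddCommGroup W] [Module K W] (hK : (3 : Cardinal) < Cardinal.mk K)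
    (U : Submodule K (V × W))
    (hU : ∀ (lam : Kˣ) (v : V) (w : W), (v, w) ∈ U →
      ((lam : K) • v, ((lam⁻¹ : Kˣ) : K) • w) ∈ U) :
    (∀ (v : V) (w : W), (v, w) ∈ U → ((v, (0 : W)) ∈ U ∧ ((0 : V), w) ∈ U)) ∧
      U = U ⊓ Submodule.prod (⊤ : Submodule K V) (⊥ : Submodule K W) ⊔
          U ⊓ Submodule.prod (⊥ : Submodule K V) (⊤ : Submodule K W) := by
  obtain ⟨lam, hlam⟩ := exists_unit_sub_inv_ne_zero hK
  have split : ∀ (v : V) (w : W), (v, w) ∈ U → ((v, (0 : W)) ∈ U ∧ ((0 : V), w) ∈ U) := by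
    intro v w h
    have hv : (v, (0 : W)) ∈ U := by
      have hsub := U.sub_mem (hU lam v w h) (U.smul_mem ((lam⁻¹ : Kˣ) : K) h)
      rw [Prod.smul_mk, Prod.mk_sub_mk, sub_self, ← sub_smul] at hsub
      have hsmul := U.smul_mem ((lam : K) - ((lam⁻¹ : Kˣ) : K))⁻¹ hsub
      rwa [Prod.smul_mk, smul_zero, smul_smul, inv_mul_cancel₀ hlam, one_smul] at hsmul
    exact ⟨hv, by simpa using U.sub_mem h hv⟩
  refine ⟨split, le_antisymm ?_ (sup_le inf_le_left inf_le_left)⟩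
  rintro ⟨v, w⟩ h
  obtain ⟨hv, hw⟩ := split v w h
  exact Submodule.mem_sup.mpr ⟨(v, 0), ⟨hv, by simp⟩, (0, w), ⟨hw, by simp⟩, by simp⟩
end
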